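/- arXiv:0907.2561 — 8 statements merged into one kernel-verified Lean document; each statement's English description precedes it below -/
import Mathlib

section
/- For every coupling J ≥ 0 and external field h ∈ ℝ, the sequence of pressures per particle (p_N)_{N≥1} of the Curie-Weiss model converges as N → ∞, and its limit equals inf_{N≥1} p_N (the sequence (N·p_N)_{N≥1} being subadditive and (p_N) bounded below). -/
open Filter

noncomputable section

/-- The value of a spin encoded by a Boolean: `+1` or `-1`. -/
def spin (b : Bool) : ℝ := if b then 1 else -1

/-- Magnetization of a configuration of `N` spins. -/
def mag (N : ℕ) (σ : Fin N → Bool) : ℝ := (∑ i, spin (σ i)) / N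

/-- Curie-Weiss Hamiltonian. -/
def ham (N : ℕ) (J h : ℝ) (σ : Fin N → Bool) : ℝ :=
  -(N * (J / 2 * mag N σ ^ 2 + h * mag N σ))

/-- Curie-Weiss partition function. -/
def Z (N : ℕ) (J h : ℝ) : ℝ := ∑ σ : Fin N → Bool, Real.exp (-ham N J h σ)

/-- Curie-Weiss pressure per particle. -/
def pressure (N : ℕ) (J h : ℝ) : ℝ := Real.log (Z N J h) / N

lemma neg_ham_eq (N : ℕ) (J h : ℝ) (σ : Fin N → Bool) :
    -ham N J h σ = J / 2 * ((∑ i, spin (σ i)) ^ 2 / N) + h * ∑ i, spin (σ i) := by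
  unfold ham mag
  rcases Nat.eq_zero_or_pos N with rfl | hN
  · simp
  · have : (N : ℝ) ≠ 0 := by positivity
    field_simp

lemma sq_div_add_le (m n : ℕ) (a b : ℝ) (hm : m = 0 → a = 0) (hn : n = 0 → b = 0) :
    (a + b) ^ 2 / ((m + n : ℕ) : ℝ) ≤ a ^ 2 / m + b ^ 2 / n := by
  rcases Nat.eq_zero_or_pos m with h0 | hm0
  · rw [hm h0, h0]; simp
  rcases Nat.eq_zero_or_pos n with h0 | hn0
  · rw [hn h0, h0]; simp
  have hm1 : (0 : ℝ) < m := by positivity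
  have hn1 : (0 : ℝ) < n := by positivity
  push_cast
  rw [div_add_div _ _ hm1.ne' hn1.ne', div_le_div_iff₀ (by positivity) (by positivity)]
  nlinarith [sq_nonneg (a * n - b * m)]

lemma Z_pos (N : ℕ) (J h : ℝ) : 0 < Z N J h :=
  Finset.sum_pos (fun _ _ => Real.exp_pos _) Finset.univ_nonempty

lemma Z_add_le (J h : ℝ) (hJ : 0 ≤ J) (m n : ℕ) : Z (m + n) J h ≤ Z m J h * Z n J h := by
  unfold Z
  rw [Finset.sum_mul_sum, ← Fintype.sum_prod_type', ← (Fin.appendEquiv m n).sum_comp]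
  apply Finset.sum_le_sum
  rintro ⟨σ, τ⟩ -
  rw [← Real.exp_add]
  apply Real.exp_le_exp.2
  rw [neg_ham_eq, neg_ham_eq, neg_ham_eq]
  have hs : ∑ i, spin (Fin.appendEquiv m n (σ, τ) i)
      = ∑ i, spin (σ i) + ∑ i, spin (τ i) := by
    rw [Fin.sum_univ_add]
    simp [Fin.appendEquiv]
  rw [hs]
  have key := sq_div_add_le m n (∑ i, spin (σ i)) (∑ i, spin (τ i))
    (by rintro rfl; simp) (by rintro rfl; simp)
  have := mul_le_mul_of_nonneg_left key (by positivity : 0 ≤ J / 2)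
  linarith

lemma log_Z_subadditive (J h : ℝ) (hJ : 0 ≤ J) : Subadditive fun N => Real.log (Z N J h) := by
  intro m n
  rw [← Real.log_mul (Z_pos _ _ _).ne' (Z_pos _ _ _).ne']
  exact Real.log_le_log (Z_pos _ _ _) (Z_add_le J h hJ m n)

lemma pressure_bddBelow (J h : ℝ) :
    BddBelow (Set.range fun N : ℕ => Real.log (Z N J h) / N) := by
  refine ⟨min 0 (J / 2 + h), ?_⟩
  rintro _ ⟨N, rfl⟩
  rcases Nat.eq_zero_or_pos N with rfl | hN
  · simp
  · have hN1 : (0 : ℝ) < N := by positivity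
    refine (min_le_right _ _).trans ?_
    show _ ≤ Real.log (Z N J h) / N
    rw [le_div_iff₀ hN1, Real.le_log_iff_exp_le (Z_pos _ _ _)]
    have h1 : (J / 2 + h) * N = -ham N J h (fun _ => true) := by
      rw [neg_ham_eq]
      simp [spin]
      field_simp
    rw [h1]
    exact Finset.single_le_sum (f := fun σ => Real.exp (-ham N J h σ))
      (fun _ _ => (Real.exp_pos _).le) (Finset.mem_univ _)

/-- For every coupling `J ≥ 0` and field `h`, the pressures per particle converge
as `N → ∞`, with limit `inf_{N ≥ 1} p_N`. -/
theorem curieWeiss_pressure_tendsto_iInf (J h : ℝ) (hJ : 0 ≤ J) :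
    Tendsto (fun N : ℕ => pressure N J h) atTop
      (nhds (⨅ n : {n : ℕ // 1 ≤ n}, pressure n J h)) := by
  have hs := log_Z_subadditive J h hJ
  have ht := hs.tendsto_lim (pressure_bddBelow J h)
  rw [Subadditive.lim, sInf_image'] at ht
  exact ht
end
end

section
/- For every N ≥ 1, every J ≥ 0 and every h ∈ ℝ, the Curie-Weiss pressure satisfies the lower bound p_N ≥ sup_{m̄∈[−1,1]} p_low(m̄), where p_low(m̄) = ln 2 − (J/2)·m̄² + ln cosh(J·m̄ + h). -/
noncomputable section

/-- The variational lower-bound functional for the Curie-Weiss pressure. -/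
def pLow (J h m : ℝ) : ℝ := Real.log 2 - J / 2 * m ^ 2 + Real.log (Real.cosh (J * m + h))

/-- Lower bound for the Curie-Weiss pressure: for every `N ≥ 1`, `J ≥ 0` and `h`,
`p_N ≥ sup_{m̄ ∈ [−1,1]} p_low(m̄)`. -/
theorem curieWeiss_pressure_lower_bound (N : ℕ) (hN : 1 ≤ N) (J h : ℝ) (hJ : 0 ≤ J) :
    sSup (pLow J h '' Set.Icc (-1 : ℝ) 1) ≤ pressure N J h := by
  have hN0 : (0 : ℝ) < N := by exact_mod_cast hN
  apply csSup_le ((Set.nonempty_Icc.mpr (by norm_num)).image _)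
  rintro _ ⟨m, -, rfl⟩
  have hc : 0 < Real.cosh (J * m + h) := Real.cosh_pos _
  have key : Real.exp (-(N * (J / 2 * m ^ 2))) * (2 * Real.cosh (J * m + h)) ^ N ≤ Z N J h := by
    have h2 : 2 * Real.cosh (J * m + h) = ∑ b : Bool, Real.exp ((J * m + h) * spin b) := by
      simp [spin, Real.cosh_eq]
      ring
    rw [h2, Fintype.sum_pow, Finset.mul_sum]
    unfold Z
    apply Finset.sum_le_sum
    intro σ _
    rw [← Real.exp_sum, ← Real.exp_add, Real.exp_le_exp, ← Finset.mul_sum]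
    have hs : ∑ i, spin (σ i) = N * mag N σ := by
      unfold mag
      field_simp
    rw [hs]
    unfold ham
    have := mul_nonneg (mul_nonneg hN0.le hJ) (sq_nonneg (mag N σ - m))
    nlinarith
  unfold pressure
  rw [le_div_iff₀ hN0]
  have h3 := Real.log_le_log (by positivity) key
  rw [Real.log_mul (by positivity) (by positivity), Real.log_exp, Real.log_pow,
    Real.log_mul (by norm_num) hc.ne'] at h3
  unfold pLow
  linarith
end
end

section
/- For every J ∈ ℝ and h ∈ ℝ, the Curie-Weiss pressure satisfies the variational lower bound liminf_{N→∞} p_N ≥ sup_{m̄∈(−1,1)} p'_low(m̄), where p'_low(m̄) = (J/2)·m̄² + h·m̄ + S(m̄). -/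
open Filter

noncomputable section

/-- Binary entropy function. -/
def binEnt (x : ℝ) : ℝ :=
  -((1 + x) / 2 * Real.log ((1 + x) / 2)) - (1 - x) / 2 * Real.log ((1 - x) / 2)

/-- The entropic variational lower-bound functional. -/
def pLow' (J h m : ℝ) : ℝ := J / 2 * m ^ 2 + h * m + binEnt m

/-- Single-spin weights. -/
def cwQ (m : ℝ) (b : Bool) : ℝ := if b then (1 + m) / 2 else (1 - m) / 2

/-- Expectation under the product measure. -/
def cwE (m : ℝ) (N : ℕ) (F : (Fin N → Bool) → ℝ) : ℝ :=
  ∑ σ : Fin N → Bool, (∏ i, cwQ m (σ i)) * F σ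

lemma cwE_succ (m : ℝ) (N : ℕ) (F : (Fin (N + 1) → Bool) → ℝ) :
    cwE m (N + 1) F = (1 + m) / 2 * cwE m N (fun σ => F (Fin.cons true σ))
      + (1 - m) / 2 * cwE m N (fun σ => F (Fin.cons false σ)) := by
  unfold cwE
  rw [← (Fin.consEquiv (fun _ : Fin (N + 1) => Bool)).sum_comp, Fintype.sum_prod_type]
  simp only [Fin.consEquiv_apply, Fintype.sum_bool, Fin.prod_univ_succ, Fin.cons_zero,
    Fin.cons_succ, Finset.mul_sum]
  simp [cwQ, mul_assoc]
  rfl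

lemma cwE_add (m : ℝ) (N : ℕ) (F G : (Fin N → Bool) → ℝ) :
    cwE m N (fun σ => F σ + G σ) = cwE m N F + cwE m N G := by
  simp [cwE, mul_add, Finset.sum_add_distrib]

lemma cwE_smul (m : ℝ) (N : ℕ) (c : ℝ) (F : (Fin N → Bool) → ℝ) :
    cwE m N (fun σ => c * F σ) = c * cwE m N F := by
  simp only [cwE, Finset.mul_sum]
  exact Finset.sum_congr rfl fun _ _ => by ring

lemma cwE_one (m : ℝ) (N : ℕ) : cwE m N (fun _ => 1) = 1 := by
  induction N with
  | zero => simp [cwE]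
  | succ n ih => rw [cwE_succ, ih]; ring

lemma cwE_const (m : ℝ) (N : ℕ) (c : ℝ) : cwE m N (fun _ => c) = c := by
  have := cwE_smul m N c (fun _ => 1)
  simpa [cwE_one] using this

lemma cwE_sum (m : ℝ) (N : ℕ) (g : Bool → ℝ) :
    cwE m N (fun σ => ∑ i, g (σ i)) = N * ((1 + m) / 2 * g true + (1 - m) / 2 * g false) := by
  induction N with
  | zero => simp [cwE]
  | succ n ih =>
    rw [cwE_succ]
    simp only [Fin.sum_univ_succ, Fin.cons_zero, Fin.cons_succ, cwE_add, cwE_const, ih]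
    push_cast; ring

lemma cwE_sq (m : ℝ) (N : ℕ) :
    cwE m N (fun σ => (∑ i, spin (σ i)) ^ 2) = N ^ 2 * m ^ 2 + N * (1 - m ^ 2) := by
  induction N with
  | zero => simp [cwE]
  | succ n ih =>
    rw [cwE_succ]
    simp only [Fin.sum_univ_succ, Fin.cons_zero, Fin.cons_succ, add_sq, cwE_add, cwE_const, ih,
      cwE_smul, cwE_sum]
    simp only [spin]
    push_cast
    simp
    ring

lemma cwQ_pos {m : ℝ} (hm : m ∈ Set.Ioo (-1 : ℝ) 1) (b : Bool) : 0 < cwQ m b := by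
  obtain ⟨h1, h2⟩ := hm
  unfold cwQ
  split_ifs <;> linarith

lemma cw_gibbs {m : ℝ} (hm : m ∈ Set.Ioo (-1 : ℝ) 1) (N : ℕ) (a : (Fin N → Bool) → ℝ) :
    cwE m N (fun σ => a σ + (-1) * ∑ i, Real.log (cwQ m (σ i)))
      ≤ Real.log (∑ σ, Real.exp (a σ)) := by
  set c := cwE m N (fun σ => a σ + (-1) * ∑ i, Real.log (cwQ m (σ i))) with hc
  have hZ : 0 < ∑ σ, Real.exp (a σ) := Finset.sum_pos (fun _ _ => Real.exp_pos _) ⟨fun _ => true, by simp⟩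
  rw [Real.le_log_iff_exp_le hZ]
  have key : cwE m N (fun σ => (a σ + (-1) * ∑ i, Real.log (cwQ m (σ i))) + (1 - c))
      ≤ ∑ σ, Real.exp (a σ) * Real.exp (-c) := by
    unfold cwE
    refine Finset.sum_le_sum fun σ _ => ?_
    have hw : (∏ i, cwQ m (σ i)) = Real.exp (∑ i, Real.log (cwQ m (σ i))) := by
      rw [Real.exp_sum]
      exact Finset.prod_congr rfl fun i _ => (Real.exp_log (cwQ_pos hm _)).symm
    rw [hw]
    set L := ∑ i, Real.log (cwQ m (σ i))
    have : Real.exp (a σ) * Real.exp (-c) = Real.exp L * Real.exp (a σ - L - c) := by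
      rw [← Real.exp_add, ← Real.exp_add]; congr 1; ring
    rw [this]
    refine mul_le_mul_of_nonneg_left ?_ (Real.exp_pos _).le
    linarith [Real.add_one_le_exp (a σ - L - c)]
  rw [cwE_add m N (fun σ => a σ + (-1) * ∑ i, Real.log (cwQ m (σ i))) (fun _ => 1 - c), ← hc,
    cwE_const, ← Finset.sum_mul, Real.exp_neg, ← div_eq_mul_inv, le_div_iff₀ (Real.exp_pos _)] at key
  linarith

lemma cw_lower {m : ℝ} (hm : m ∈ Set.Ioo (-1 : ℝ) 1) (J h : ℝ) (N : ℕ) (hN : 0 < N) :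
    pLow' J h m + J / 2 * (1 - m ^ 2) / N ≤ pressure N J h := by
  have hN' : (0 : ℝ) < N := by exact_mod_cast hN
  unfold pressure Z
  rw [le_div_iff₀ hN']
  refine le_trans (le_of_eq ?_) (cw_gibbs hm N _)
  have e : ∀ σ : Fin N → Bool, -ham N J h σ =
      J / 2 / N * (∑ i, spin (σ i)) ^ 2 + h * ∑ i, spin (σ i) := by
    intro σ
    unfold ham mag
    field_simp
  simp only [e]
  rw [cwE_add, cwE_add, cwE_smul, cwE_smul, cwE_smul, cwE_sq, cwE_sum,
    cwE_sum m N (fun b => Real.log (cwQ m b))]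
  simp only [pLow', binEnt, cwQ, spin]
  simp
  field_simp
  ring

lemma cw_upper (J h : ℝ) (N : ℕ) (hN : 0 < N) :
    pressure N J h ≤ Real.log 2 + (|J| / 2 + |h|) := by
  have hN' : (0 : ℝ) < N := by exact_mod_cast hN
  unfold pressure
  rw [div_le_iff₀ hN']
  have hZ : 0 < Z N J h := Finset.sum_pos (fun _ _ => Real.exp_pos _) ⟨fun _ => true, by simp⟩
  have hb : Z N J h ≤ ∑ σ : Fin N → Bool, Real.exp (N * (|J| / 2 + |h|)) := by
    refine Finset.sum_le_sum fun σ _ => Real.exp_le_exp.2 ?_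
    unfold ham
    rw [neg_neg]
    refine mul_le_mul_of_nonneg_left ?_ hN'.le
    have hm : |mag N σ| ≤ 1 := by
      unfold mag
      rw [abs_div, abs_of_pos hN', div_le_one hN']
      refine (Finset.abs_sum_le_sum_abs _ _).trans (le_of_eq ?_)
      have : ∀ b, |spin b| = 1 := by intro b; cases b <;> simp [spin]
      simp [this]
    have h1 : J / 2 * mag N σ ^ 2 ≤ |J| / 2 := by
      have : mag N σ ^ 2 ≤ 1 := (sq_le_one_iff_abs_le_one _).2 hm
      nlinarith [le_abs_self J, abs_nonneg J, sq_nonneg (mag N σ)]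
    have h2 : h * mag N σ ≤ |h| := by
      refine (le_abs_self _).trans ?_
      rw [abs_mul]
      exact mul_le_of_le_one_right (abs_nonneg _) hm
    linarith
  refine (Real.log_le_log hZ hb).trans (le_of_eq ?_)
  simp only [Finset.sum_const, Finset.card_univ, Fintype.card_fun, Fintype.card_bool,
    Fintype.card_fin, nsmul_eq_mul]
  push_cast
  rw [Real.log_mul (by positivity) (Real.exp_pos _).ne', Real.log_exp, Real.log_pow]
  ring

/-- Variational lower bound: for every `J` and `h`,
`liminf_{N→∞} p_N ≥ sup_{m̄ ∈ (−1,1)} p'_low(m̄)`. -/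
theorem curieWeiss_variational_lower_bound (J h : ℝ) :
    sSup (pLow' J h '' Set.Ioo (-1 : ℝ) 1) ≤
      liminf (fun N : ℕ => pressure N J h) atTop := by
  refine csSup_le ⟨_, 0, by norm_num, rfl⟩ ?_
  rintro _ ⟨m, hm, rfl⟩
  have hcob : IsCoboundedUnder (· ≥ ·) atTop (fun N : ℕ => pressure N J h) := by
    refine IsBoundedUnder.isCoboundedUnder_ge ⟨Real.log 2 + (|J| / 2 + |h|), ?_⟩
    rw [eventually_map]
    filter_upwards [eventually_gt_atTop 0] with N hN using cw_upper J h N hN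
  have ht : Tendsto (fun N : ℕ => pLow' J h m + J / 2 * (1 - m ^ 2) / N) atTop
      (nhds (pLow' J h m)) := by
    simpa using (tendsto_const_div_atTop_nhds_zero_nat (J / 2 * (1 - m ^ 2))).const_add
      (pLow' J h m)
  refine le_of_forall_lt fun c hc => ?_
  obtain ⟨d, hcd, hd⟩ := exists_between hc
  refine hcd.trans_le (le_liminf_of_le hcob ?_)
  filter_upwards [eventually_gt_atTop 0, ht.eventually_const_lt hd] with N hN h1
  exact h1.le.trans (cw_lower hm J h N hN)
end
end

section
/- Let J > 0 and h ∈ ℝ. The Legendre transform of the function f(x) = (1/J)·ln(2·cosh(J·x + h)) on ℝ is given, for every y ∈ (−1,1), by f*(y) := sup_{x∈ℝ} ( x·y − f(x) ) = (1/J)·( ((1+y)/2)·ln((1+y)/2) + ((1−y)/2)·ln((1−y)/2) − y·h ). -/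
noncomputable section

theorem aux_upper (p q t : ℝ) (hp : 0 < p) (hq : 0 < q) (hpq : p + q = 1) :
    t * (p - q) - Real.log (2 * Real.cosh t) ≤ p * Real.log p + q * Real.log q := by
  have hZ : 0 < 2 * Real.cosh t := by have := Real.cosh_pos t; positivity
  have hZe : 2 * Real.cosh t = Real.exp t + Real.exp (-t) := by rw [Real.cosh_eq]; ring
  generalize 2 * Real.cosh t = Z at hZ hZe ⊢
  have key : ∀ r s : ℝ, 0 < r → r * (s - Real.log r - Real.log Z) ≤ Real.exp s / Z - r := by
    intro r s hr
    have h1 := Real.log_le_sub_one_of_pos (show 0 < Real.exp s / (r * Z) by positivity)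
    rw [Real.log_div (by positivity) (by positivity), Real.log_exp,
      Real.log_mul hr.ne' hZ.ne'] at h1
    have h2 := mul_le_mul_of_nonneg_left h1 hr.le
    have h3 : r * (Real.exp s / (r * Z) - 1) = Real.exp s / Z - r := by
      field_simp
    rw [h3] at h2
    linarith
  have h1 := key p t hp
  have h2 := key q (-t) hq
  have h3 : Real.exp t / Z + Real.exp (-t) / Z = 1 := by
    rw [← add_div, ← hZe, div_self hZ.ne']
  have h4 : Real.log Z = p * Real.log Z + q * Real.log Z := by rw [← add_mul, hpq, one_mul]
  nlinarith

theorem aux_eq (p q : ℝ) (hp : 0 < p) (hq : 0 < q) (hpq : p + q = 1) :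
    (Real.log p - Real.log q) / 2 * (p - q)
      - Real.log (2 * Real.cosh ((Real.log p - Real.log q) / 2))
      = p * Real.log p + q * Real.log q := by
  have h1 : 2 * Real.cosh ((Real.log p - Real.log q) / 2)
      = Real.exp (-(Real.log p + Real.log q) / 2) := by
    have e1 : (Real.log p - Real.log q) / 2
        = -(Real.log p + Real.log q) / 2 + Real.log p := by ring
    have e2 : -((Real.log p - Real.log q) / 2)
        = -(Real.log p + Real.log q) / 2 + Real.log q := by ring
    rw [Real.cosh_eq, e2, e1, Real.exp_add, Real.exp_add, Real.exp_log hp, Real.exp_log hq]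
    linear_combination Real.exp (-(Real.log p + Real.log q) / 2) * hpq
  rw [h1, Real.log_exp]
  obtain rfl : q = 1 - p := by linarith
  ring

/-- Legendre transform of `f(x) = (1/J)·ln(2·cosh(J·x + h))`: for `J > 0`, `h ∈ ℝ` and
`y ∈ (−1,1)`,
`sup_x (x·y − f(x)) = (1/J)·(((1+y)/2)·ln((1+y)/2) + ((1−y)/2)·ln((1−y)/2) − y·h)`. -/
theorem legendre_transform_log_cosh (J h : ℝ) (hJ : 0 < J) (y : ℝ)
    (hy : y ∈ Set.Ioo (-1 : ℝ) 1) :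
    (⨆ x : ℝ, (x * y - 1 / J * Real.log (2 * Real.cosh (J * x + h)))) =
      1 / J * ((1 + y) / 2 * Real.log ((1 + y) / 2)
        + (1 - y) / 2 * Real.log ((1 - y) / 2) - y * h) := by
  obtain ⟨hy1, hy2⟩ := hy
  have hp : 0 < (1 + y) / 2 := by linarith
  have hq : 0 < (1 - y) / 2 := by linarith
  have hpq : (1 + y) / 2 + (1 - y) / 2 = 1 := by ring
  have hsub : (1 + y) / 2 - (1 - y) / 2 = y := by ring
  have hrw : ∀ x : ℝ, x * y - 1 / J * Real.log (2 * Real.cosh (J * x + h))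
      = 1 / J * ((J * x + h) * y - Real.log (2 * Real.cosh (J * x + h)) - y * h) := by
    intro x
    field_simp
    ring
  have hub : ∀ x : ℝ, x * y - 1 / J * Real.log (2 * Real.cosh (J * x + h)) ≤
      1 / J * ((1 + y) / 2 * Real.log ((1 + y) / 2)
        + (1 - y) / 2 * Real.log ((1 - y) / 2) - y * h) := by
    intro x
    rw [hrw]
    have := aux_upper _ _ (J * x + h) hp hq hpq
    rw [hsub] at this
    apply mul_le_mul_of_nonneg_left _ (by positivity)
    linarith
  apply le_antisymm (ciSup_le hub)
  have hbdd : BddAbove (Set.range fun x : ℝ =>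
      x * y - 1 / J * Real.log (2 * Real.cosh (J * x + h))) := by
    exact ⟨_, Set.forall_mem_range.2 hub⟩
  refine le_ciSup_of_le hbdd
    (((Real.log ((1 + y) / 2) - Real.log ((1 - y) / 2)) / 2 - h) / J) ?_
  rw [hrw]
  have h1 := aux_eq _ _ hp hq hpq
  rw [hsub] at h1
  rw [mul_div_cancel₀ _ hJ.ne', sub_add_cancel, h1]
end
end

section
/- Exact solution of the Curie-Weiss model: for every J ≥ 0 and h ∈ ℝ, the limit p = lim_{N→∞} p_N exists and equals both sup_{m̄∈[−1,1]} ( ln 2 − (J/2)·m̄² + ln cosh(J·m̄ + h) ) and sup_{m̄∈(−1,1)} ( (J/2)·m̄² + h·m̄ + S(m̄) ). -/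
open Filter

noncomputable section

/-- The variational upper-bound functional for the Curie-Weiss pressure. -/
def pUp (J h m : ℝ) : ℝ := Real.log 2 - J / 2 * m ^ 2 + Real.log (Real.cosh (J * m + h))

theorem sum_exp_spin (N : ℕ) (t : ℝ) :
    ∑ σ : Fin N → Bool, Real.exp (t * ∑ i, spin (σ i)) = (2 * Real.cosh t) ^ N := by
  have h1 : ∀ σ : Fin N → Bool,
      Real.exp (t * ∑ i, spin (σ i)) = ∏ i, Real.exp (t * spin (σ i)) := by
    intro σ
    rw [Finset.mul_sum, Real.exp_sum]
  have h2 : (2 * Real.cosh t) ^ N = ∏ _i : Fin N, ∑ b : Bool, Real.exp (t * spin b) := by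
    simp [spin, Real.cosh_eq]
    congr 1
    ring
  rw [h2, Finset.prod_univ_sum, Fintype.piFinset_univ]
  exact Finset.sum_congr rfl fun σ _ => h1 σ

theorem sum_exp_mag (N : ℕ) (hN : 0 < N) (J h m : ℝ) :
    ∑ σ : Fin N → Bool, Real.exp (N * (-(J / 2 * m ^ 2) + (J * m + h) * mag N σ)) =
      Real.exp (N * pUp J h m) := by
  have hN' : (N : ℝ) ≠ 0 := by positivity
  have hc : 0 < Real.cosh (J * m + h) := Real.cosh_pos _
  have h1 : ∀ σ : Fin N → Bool,
      Real.exp (N * (-(J / 2 * m ^ 2) + (J * m + h) * mag N σ)) =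
        Real.exp (N * (-(J / 2 * m ^ 2))) * Real.exp ((J * m + h) * ∑ i, spin (σ i)) := by
    intro σ
    rw [← Real.exp_add]
    congr 1
    unfold mag
    field_simp
  rw [Finset.sum_congr rfl fun σ _ => h1 σ, ← Finset.mul_sum, sum_exp_spin]
  have h2 : pUp J h m = -(J / 2 * m ^ 2) + Real.log (2 * Real.cosh (J * m + h)) := by
    rw [Real.log_mul (by norm_num) hc.ne']
    unfold pUp
    ring
  rw [h2, mul_add, Real.exp_add]
  congr 1
  rw [Real.exp_nat_mul, Real.exp_log (by positivity)]

theorem Z_lower (N : ℕ) (hN : 0 < N) (J h m : ℝ) (hJ : 0 ≤ J) :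
    Real.exp (N * pUp J h m) ≤ Z N J h := by
  rw [← sum_exp_mag N hN]
  unfold Z ham
  refine Finset.sum_le_sum fun σ _ => Real.exp_le_exp.2 ?_
  rw [neg_neg]
  refine mul_le_mul_of_nonneg_left ?_ (Nat.cast_nonneg N)
  nlinarith [mul_nonneg hJ (sq_nonneg (mag N σ - m))]

theorem mag_eq (N : ℕ) (σ : Fin N → Bool) :
    ∃ k ∈ Finset.range (N + 1), mag N σ = (2 * (k : ℝ) - N) / N := by
  refine ⟨(Finset.univ.filter fun i => σ i = true).card, ?_, ?_⟩
  · have := Finset.card_filter_le (Finset.univ : Finset (Fin N)) (fun i => σ i = true)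
    simp only [Finset.card_univ, Fintype.card_fin] at this
    simp only [Finset.mem_range]
    omega
  · unfold mag
    congr 1
    have h1 : ∀ b : Bool, spin b = 2 * (if b = true then (1 : ℝ) else 0) - 1 := by
      intro b
      cases b <;> norm_num [spin]
    rw [Finset.sum_congr rfl fun i _ => h1 (σ i), Finset.sum_sub_distrib, ← Finset.mul_sum,
      Finset.sum_boole]
    simp

theorem Z_upper (N : ℕ) (hN : 0 < N) (J h B : ℝ)
    (hB : ∀ m ∈ Set.Icc (-1 : ℝ) 1, pUp J h m ≤ B) :
    Z N J h ≤ (N + 1) * Real.exp (N * B) := by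
  have hN' : (0 : ℝ) < N := by exact_mod_cast hN
  have h1 : Z N J h ≤ ∑ σ : Fin N → Bool, ∑ k ∈ Finset.range (N + 1),
      Real.exp (N * (-(J / 2 * ((2 * (k : ℝ) - N) / N) ^ 2) +
        (J * ((2 * (k : ℝ) - N) / N) + h) * mag N σ)) := by
    unfold Z ham
    refine Finset.sum_le_sum fun σ _ => ?_
    obtain ⟨k, hk, hm⟩ := mag_eq N σ
    refine le_trans (le_of_eq ?_) (Finset.single_le_sum
      (f := fun k : ℕ => Real.exp (N * (-(J / 2 * ((2 * (k : ℝ) - N) / N) ^ 2) +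
        (J * ((2 * (k : ℝ) - N) / N) + h) * mag N σ)))
      (fun _ _ => (Real.exp_pos _).le) hk)
    simp only [← hm]
    congr 1
    ring
  refine h1.trans ?_
  rw [Finset.sum_comm]
  have h2 : ∀ k ∈ Finset.range (N + 1), ∑ σ : Fin N → Bool,
      Real.exp (N * (-(J / 2 * ((2 * (k : ℝ) - N) / N) ^ 2) +
        (J * ((2 * (k : ℝ) - N) / N) + h) * mag N σ)) ≤ Real.exp (N * B) := by
    intro k hk
    rw [sum_exp_mag N hN]
    have hk' : (k : ℝ) ≤ N := by
      have : k ≤ N := by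
        have := Finset.mem_range.1 hk
        omega
      exact_mod_cast this
    have hk0 : (0 : ℝ) ≤ k := Nat.cast_nonneg k
    refine Real.exp_le_exp.2 (mul_le_mul_of_nonneg_left (hB _ ⟨?_, ?_⟩) hN'.le)
    · rw [le_div_iff₀ hN']
      linarith
    · rw [div_le_iff₀ hN']
      linarith
  refine (Finset.sum_le_sum h2).trans (le_of_eq ?_)
  simp

theorem gibbs_le (t m : ℝ) (hm : m ∈ Set.Ioo (-1 : ℝ) 1) :
    t * m + binEnt m ≤ Real.log (2 * Real.cosh t) := by
  obtain ⟨h1, h2⟩ := hm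
  have hp : 0 < (1 + m) / 2 := by linarith
  have hq : 0 < (1 - m) / 2 := by linarith
  have hC : 0 < 2 * Real.cosh t := by have := Real.cosh_pos t; positivity
  have key : ∀ p s : ℝ, 0 < p →
      p * (s - Real.log p - Real.log (2 * Real.cosh t)) ≤ Real.exp s / (2 * Real.cosh t) - p := by
    intro p s hp
    have := Real.log_le_sub_one_of_pos (x := Real.exp s / (p * (2 * Real.cosh t))) (by positivity)
    rw [Real.log_div (by positivity) (by positivity), Real.log_exp,
      Real.log_mul hp.ne' hC.ne'] at this
    have h3 := mul_le_mul_of_nonneg_left this hp.le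
    have h4 : p * (Real.exp s / (p * (2 * Real.cosh t)) - 1) =
        Real.exp s / (2 * Real.cosh t) - p := by
      field_simp
    rw [h4] at h3
    linarith
  have k1 := key _ t hp
  have k2 := key _ (-t) hq
  have k3 : Real.exp t / (2 * Real.cosh t) + Real.exp (-t) / (2 * Real.cosh t) = 1 := by
    rw [← add_div, div_eq_one_iff_eq hC.ne', Real.cosh_eq]
    ring
  unfold binEnt
  nlinarith

theorem gibbs_eq (t : ℝ) :
    ∃ x ∈ Set.Ioo (-1 : ℝ) 1, t * x + binEnt x = Real.log (2 * Real.cosh t) := by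
  have hC : 0 < 2 * Real.cosh t := by have := Real.cosh_pos t; positivity
  have hE : 2 * Real.cosh t = Real.exp t + Real.exp (-t) := by rw [Real.cosh_eq]; ring
  have e1 := Real.exp_pos t
  have e2 := Real.exp_pos (-t)
  refine ⟨(Real.exp t - Real.exp (-t)) / (2 * Real.cosh t), ⟨?_, ?_⟩, ?_⟩
  · rw [lt_div_iff₀ hC, hE]
    linarith
  · rw [div_lt_iff₀ hC, hE]
    linarith
  · have k3 : Real.exp t / (2 * Real.cosh t) + Real.exp (-t) / (2 * Real.cosh t) = 1 := by
      rw [← add_div, div_eq_one_iff_eq hC.ne', hE]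
    have hp : (1 + (Real.exp t - Real.exp (-t)) / (2 * Real.cosh t)) / 2 =
        Real.exp t / (2 * Real.cosh t) := by
      rw [sub_div]
      linarith
    have hq : (1 - (Real.exp t - Real.exp (-t)) / (2 * Real.cosh t)) / 2 =
        Real.exp (-t) / (2 * Real.cosh t) := by
      rw [sub_div]
      linarith
    unfold binEnt
    rw [hp, hq, Real.log_div e1.ne' hC.ne', Real.log_div e2.ne' hC.ne', Real.log_exp,
      Real.log_exp, sub_div]
    linear_combination (Real.log (2 * Real.cosh t)) * k3

theorem pUp_eq (J h m : ℝ) :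
    pUp J h m = -(J / 2 * m ^ 2) + Real.log (2 * Real.cosh (J * m + h)) := by
  rw [Real.log_mul (by norm_num) (Real.cosh_pos _).ne']
  unfold pUp
  ring

theorem pUp_bdd (J h : ℝ) : BddAbove (pUp J h '' Set.Icc (-1 : ℝ) 1) := by
  refine (isCompact_Icc.image ?_).bddAbove
  unfold pUp
  refine Continuous.add (by fun_prop) (Continuous.log ?_ fun m => (Real.cosh_pos _).ne')
  exact Real.continuous_cosh.comp (by fun_prop)

/-- Exact solution of the Curie-Weiss model: for `J ≥ 0` and `h ∈ ℝ`, the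
thermodynamic limit of the pressure exists and equals both
`sup_{m̄ ∈ [−1,1]} (ln 2 − (J/2)m̄² + ln cosh(Jm̄ + h))` and
`sup_{m̄ ∈ (−1,1)} ((J/2)m̄² + hm̄ + S(m̄))`. -/
theorem curieWeiss_exact_solution (J h : ℝ) (hJ : 0 ≤ J) :
    Tendsto (fun N : ℕ => pressure N J h) atTop
        (nhds (sSup (pUp J h '' Set.Icc (-1 : ℝ) 1))) ∧
      sSup (pUp J h '' Set.Icc (-1 : ℝ) 1) = sSup (pLow' J h '' Set.Ioo (-1 : ℝ) 1) := by
  have hbdd := pUp_bdd J h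
  have hLU : ∀ m ∈ Set.Ioo (-1 : ℝ) 1, pLow' J h m ≤ pUp J h m := by
    intro m hm
    have := gibbs_le (J * m + h) m hm
    rw [pUp_eq]
    unfold pLow'
    nlinarith
  have hle : ∀ m ∈ Set.Ioo (-1 : ℝ) 1,
      pLow' J h m ≤ sSup (pUp J h '' Set.Icc (-1 : ℝ) 1) := fun m hm =>
    (hLU m hm).trans (le_csSup hbdd ⟨m, Set.Ioo_subset_Icc_self hm, rfl⟩)
  refine ⟨?_, le_antisymm ?_ ?_⟩
  · set P := sSup (pUp J h '' Set.Icc (-1 : ℝ) 1) with hP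
    have hlow : ∀ᶠ N : ℕ in atTop, P ≤ pressure N J h := by
      filter_upwards [eventually_gt_atTop 0] with N hN
      have hN' : (0 : ℝ) < N := by exact_mod_cast hN
      refine csSup_le ⟨_, ⟨0, by norm_num, rfl⟩⟩ ?_
      rintro _ ⟨m, -, rfl⟩
      have hz := Z_lower N hN J h m hJ
      unfold pressure
      rw [le_div_iff₀ hN', mul_comm,
        Real.le_log_iff_exp_le (lt_of_lt_of_le (Real.exp_pos _) hz)]
      exact hz
    have hup : ∀ᶠ N : ℕ in atTop,
        pressure N J h ≤ Real.log ((N : ℝ) + 1) / N + P := by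
      filter_upwards [eventually_gt_atTop 0] with N hN
      have hN' : (0 : ℝ) < N := by exact_mod_cast hN
      have hz := Z_upper N hN J h P fun m hm => le_csSup hbdd ⟨m, hm, rfl⟩
      have hz0 : 0 < Z N J h := lt_of_lt_of_le (Real.exp_pos _) (Z_lower N hN J h 0 hJ)
      have hl := Real.log_le_log hz0 hz
      rw [Real.log_mul (by positivity) (Real.exp_pos _).ne', Real.log_exp] at hl
      unfold pressure
      rw [div_le_iff₀ hN', add_mul, div_mul_cancel₀ _ hN'.ne']
      linarith
    have hlim0 : Tendsto (fun N : ℕ => Real.log ((N : ℝ) + 1) / N) atTop (nhds 0) := by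
      have h1 : Tendsto (fun x : ℝ => Real.log x / (1 * x + -1)) atTop (nhds 0) := by
        simpa using Real.tendsto_pow_log_div_mul_add_atTop 1 (-1) 1 one_ne_zero
      have h2 : Tendsto (fun N : ℕ => (N : ℝ) + 1) atTop atTop :=
        tendsto_atTop_add_const_right _ _ tendsto_natCast_atTop_atTop
      have h3 := h1.comp h2
      refine h3.congr fun N => ?_
      simp
    have hlim : Tendsto (fun N : ℕ => Real.log ((N : ℝ) + 1) / N + P) atTop (nhds P) := by
      simpa using hlim0.add_const P
    exact tendsto_of_tendsto_of_tendsto_of_le_of_le' tendsto_const_nhds hlim hlow hup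
  · refine csSup_le ⟨_, ⟨0, by norm_num, rfl⟩⟩ ?_
    rintro _ ⟨m, -, rfl⟩
    obtain ⟨x, hx, hxe⟩ := gibbs_eq (J * m + h)
    have hb : BddAbove (pLow' J h '' Set.Ioo (-1 : ℝ) 1) := by
      refine ⟨sSup (pUp J h '' Set.Icc (-1 : ℝ) 1), ?_⟩
      rintro _ ⟨y, hy, rfl⟩
      exact hle y hy
    refine le_trans ?_ (le_csSup hb ⟨x, hx, rfl⟩)
    rw [pUp_eq, ← hxe]
    unfold pLow'
    nlinarith [mul_nonneg hJ (sq_nonneg (x - m))]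
  · refine csSup_le ⟨_, ⟨0, by norm_num, rfl⟩⟩ ?_
    rintro _ ⟨m, hm, rfl⟩
    exact hle m hm
end
end

section
/- Consistency (mean field) equation: let J > 0 and h ∈ ℝ, and let p_up(m̄) = ln 2 − (J/2)·m̄² + ln cosh(J·m̄ + h) on [−1,1]. Then every point m̄* ∈ [−1,1] at which p_up attains its supremum over [−1,1] lies in the open interval (−1,1) and satisfies the mean field equation m̄* = tanh(J·m̄* + h). -/
noncomputable section

/-- Tangent-line inequality for the convex function `log cosh`. -/
lemma log_cosh_tangent (x d : ℝ) :
    Real.log (Real.cosh x) + Real.tanh x * d ≤ Real.log (Real.cosh (x + d)) := by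
  have hc := Real.cosh_pos x
  have h1 := Real.tanh_lt_one x
  have h2 := Real.neg_one_lt_tanh x
  have key : Real.exp (Real.tanh x * d) ≤ Real.cosh d + Real.tanh x * Real.sinh d := by
    have := convexOn_exp.2 (Set.mem_univ d) (Set.mem_univ (-d))
      (show 0 ≤ (1 + Real.tanh x) / 2 by linarith) (show 0 ≤ (1 - Real.tanh x) / 2 by linarith)
      (by ring)
    simp only [smul_eq_mul] at this
    rw [Real.cosh_eq, Real.sinh_eq]
    have e : (1 + Real.tanh x) / 2 * d + (1 - Real.tanh x) / 2 * -d = Real.tanh x * d := by ring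
    rw [e] at this
    linarith
  have hadd : Real.cosh (x + d) = Real.cosh x * (Real.cosh d + Real.tanh x * Real.sinh d) := by
    rw [Real.cosh_add, Real.tanh_eq_sinh_div_cosh]
    field_simp
  have hpos := lt_of_lt_of_le (Real.exp_pos (Real.tanh x * d)) key
  rw [hadd, Real.log_mul hc.ne' hpos.ne']
  have := (Real.le_log_iff_exp_le hpos).2 key
  linarith

/-- Consistency (mean field) equation: for `J > 0` and `h ∈ ℝ`, every point of `[−1,1]`
at which `p_up` attains its supremum over `[−1,1]` lies in `(−1,1)` and satisfies
`m̄* = tanh(J·m̄* + h)`. -/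
theorem curieWeiss_mean_field_equation (J h : ℝ) (hJ : 0 < J) (m : ℝ)
    (hm : m ∈ Set.Icc (-1 : ℝ) 1)
    (hmax : ∀ x ∈ Set.Icc (-1 : ℝ) 1, pUp J h x ≤ pUp J h m) :
    m ∈ Set.Ioo (-1 : ℝ) 1 ∧ m = Real.tanh (J * m + h) := by
  have h1 := Real.tanh_lt_one (J * m + h)
  have h2 := Real.neg_one_lt_tanh (J * m + h)
  have hM := hmax (Real.tanh (J * m + h)) ⟨h2.le, h1.le⟩
  have hT := log_cosh_tangent (J * m + h) (J * (Real.tanh (J * m + h) - m))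
  have e : J * m + h + J * (Real.tanh (J * m + h) - m) = J * Real.tanh (J * m + h) + h := by ring
  rw [e] at hT
  unfold pUp at hM
  generalize Real.tanh (J * m + h) = t at *
  have h0 : J * (t - m) ^ 2 ≤ 0 := by linarith
  have h3 : (t - m) ^ 2 = 0 :=
    le_antisymm (nonpos_of_mul_nonpos_right h0 hJ) (sq_nonneg _)
  have h4 : m = t := by
    have := pow_eq_zero_iff (two_ne_zero) |>.1 h3
    linarith
  exact ⟨⟨by linarith, by linarith⟩, h4⟩
end
end

section
/- Existence of the thermodynamic limit for the p-population mean field model with r-body interactions: fix p ≥ 1, fractions α_1,…,α_p ∈ (0,1) with Σ_g α_g = 1, and real coefficients J_{i_1,…,i_r} for every r ∈ {1,…,p} and all indices i_1,…,i_r ∈ {1,…,p}. For each N let {P_1^N,…,P_p^N} be a partition of {1,…,N} with |P_g^N| = N_g ≥ 1 and N_g/N → α_g as N → ∞, let m_g(σ) = (1/N_g)·Σ_{i∈P_g^N} σ_i for σ ∈ {−1,+1}^N, let H_N(σ) = −N·Σ_{r=1}^p Σ_{i_1,…,i_r=1}^p J_{i_1,…,i_r}·Π_{k=1}^r m_{i_k}(σ),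 and let p_N = (1/N)·ln Σ_{σ∈{−1,+1}^N} exp(−H_N(σ)). Then the sequence (p_N) converges to a finite limit as N → ∞. -/
open Filter

noncomputable section

/-- The spin observable at site `i` in a system of `N` spins (with a junk value `0`
when `i ≥ N`). -/
def spinAt (N i : ℕ) (σ : Fin N → Bool) : ℝ :=
  if hi : i < N then spin (σ ⟨i, hi⟩) else 0

/-- Group magnetization of group `g` for the partition `P`. -/
def groupMag {p : ℕ} (P : ℕ → Fin p → Finset ℕ) (N : ℕ) (g : Fin p)
    (σ : Fin N → Bool) : ℝ :=
  (∑ i ∈ P N g, spinAt N i σ) / ((P N g).card : ℝ)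

/-- Hamiltonian of the `p`-population mean field model with `r`-body interactions,
`r = 1, …, p`: `H_N(σ) = −N·Σ_{r=1}^p Σ_{i_1,…,i_r} J_{i_1,…,i_r}·Π_k m_{i_k}(σ)`.
Here `r`-tuples of indices are encoded as maps `Fin ((r : ℕ) + 1) → Fin p` with
`r : Fin p`, so that the tuple length runs over `1, …, p`. -/
def hamMulti {p : ℕ} (J : (r : Fin p) → (Fin ((r : ℕ) + 1) → Fin p) → ℝ)
    (P : ℕ → Fin p → Finset ℕ) (N : ℕ) (σ : Fin N → Bool) : ℝ :=
  -(N * ∑ r : Fin p, ∑ idx : Fin ((r : ℕ) + 1) → Fin p,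
      J r idx * ∏ k, groupMag P N (idx k) σ)

/-- Pressure per particle of the `p`-population model. -/
def pressureMulti {p : ℕ} (J : (r : Fin p) → (Fin ((r : ℕ) + 1) → Fin p) → ℝ)
    (P : ℕ → Fin p → Finset ℕ) (N : ℕ) : ℝ :=
  Real.log (∑ σ : Fin N → Bool, Real.exp (-hamMulti J P N σ)) / N


lemma fac_pow (k j : ℕ) : k ^ j * k.factorial ≤ k ^ k * j.factorial := by
  rcases le_total k j with h | h
  · have := Nat.factorial_mul_pow_sub_le_factorial h
    calc k ^ j * k.factorial = k ^ k * (k.factorial * k ^ (j - k)) := by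
          rw [← Nat.add_sub_of_le h, pow_add]; simp; ring
      _ ≤ _ := by gcongr
  · have h2 : k.factorial ≤ j.factorial * k ^ (k - j) := by
      have := Nat.factorial_mul_pow_le_factorial (n := j) (m := k - j)
      have h3 := Nat.factorial_mul_descFactorial (n := k) (k := k - j) (by omega)
      rw [← h3, show k - (k - j) = j by omega]
      gcongr
      exact Nat.descFactorial_le_pow _ _
    calc k ^ j * k.factorial ≤ k ^ j * (j.factorial * k ^ (k - j)) := by gcongr
      _ = k ^ (j + (k - j)) * j.factorial := by rw [pow_add]; ring
      _ = _ := by rw [Nat.add_sub_of_le h]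

lemma exp_mul_log_div (k n : ℕ) (hn : 1 ≤ n) :
    Real.exp (k * Real.log (k / n)) = ((k : ℝ) / n) ^ k := by
  rcases Nat.eq_zero_or_pos k with rfl | hk
  · simp
  · rw [Real.exp_nat_mul, Real.exp_log (by positivity)]

lemma exp_entropy (k n : ℕ) (hn : 1 ≤ n) (hk : k ≤ n) :
    Real.exp (n * Real.binEntropy (k / n)) *
      (((k : ℝ) / n) ^ k * (((n - k : ℕ) : ℝ) / n) ^ (n - k)) = 1 := by
  rw [← exp_mul_log_div k n hn, ← exp_mul_log_div (n - k) n hn, ← Real.exp_add, ← Real.exp_add,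
    Real.exp_eq_one_iff, Real.binEntropy]
  have hn' : (n : ℝ) ≠ 0 := by positivity
  have : (1 : ℝ) - k / n = ((n - k : ℕ) : ℝ) / n := by
    rw [Nat.cast_sub hk]; field_simp
  rw [this, Real.log_inv, Real.log_inv]
  field_simp
  ring

lemma binom_sum (k n : ℕ) (hn : 1 ≤ n) (hk : k ≤ n) :
    ∑ j ∈ Finset.range (n + 1),
      ((k : ℝ) / n) ^ j * (((n - k : ℕ) : ℝ) / n) ^ (n - j) * (n.choose j : ℝ) = 1 := by
  rw [← add_pow]
  have hn' : (n : ℝ) ≠ 0 := by positivity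
  rw [Nat.cast_sub hk, ← add_div]
  simp [hn']

lemma choose_upper (k n : ℕ) (hn : 1 ≤ n) (hk : k ≤ n) :
    (n.choose k : ℝ) ≤ Real.exp (n * Real.binEntropy (k / n)) := by
  have h1 := exp_entropy k n hn hk
  have h2 := binom_sum k n hn hk
  have h3 := Finset.single_le_sum (f := fun j => ((k : ℝ) / n) ^ j *
    (((n - k : ℕ) : ℝ) / n) ^ (n - j) * (n.choose j : ℝ)) (s := Finset.range (n + 1))
    (fun j _ => by positivity) (Finset.mem_range.2 (by omega : k < n + 1))
  rw [h2] at h3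
  set T := ((k : ℝ) / n) ^ k * (((n - k : ℕ) : ℝ) / n) ^ (n - k) with hT
  have hT0 : 0 ≤ T := by positivity
  have hE := Real.exp_pos (n * Real.binEntropy ((k : ℝ) / n))
  have hTp : 0 < T := by
    rcases hT0.eq_or_lt with h | h
    · rw [← h] at h1; simp at h1
    · exact h
  nlinarith [mul_le_mul_of_nonneg_left h3 hE.le]

lemma term_le (k n j : ℕ) (hk : k ≤ n) (hj : j ≤ n) :
    ((k : ℝ) / n) ^ j * (((n - k : ℕ) : ℝ) / n) ^ (n - j) * (n.choose j : ℝ) ≤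
    ((k : ℝ) / n) ^ k * (((n - k : ℕ) : ℝ) / n) ^ (n - k) * (n.choose k : ℝ) := by
  have key : ∀ a b : ℕ, (a : ℝ) ^ b / b.factorial ≤ (a : ℝ) ^ a / a.factorial := by
    intro a b
    rw [div_le_div_iff₀ (by positivity) (by positivity)]
    exact_mod_cast fac_pow a b
  have form : ∀ i : ℕ, i ≤ n → 
    ((k : ℝ) / n) ^ i * (((n - k : ℕ) : ℝ) / n) ^ (n - i) * (n.choose i : ℝ) =
      n.factorial / (n : ℝ) ^ n * (((k : ℝ) ^ i / i.factorial) *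
        (((n - k : ℕ) : ℝ) ^ (n - i) / (n - i).factorial)) := by
    intro i hi
    rw [Nat.cast_choose ℝ hi, div_pow, div_pow]
    have : (n : ℝ) ^ n = n ^ i * n ^ (n - i) := by rw [← pow_add, Nat.add_sub_of_le hi]
    rw [this]
    ring
  rw [form j hj, form k hk]
  exact mul_le_mul_of_nonneg_left
    (mul_le_mul (key k j) (key (n - k) (n - j)) (by positivity) (by positivity)) (by positivity)

lemma choose_lower (k n : ℕ) (hn : 1 ≤ n) (hk : k ≤ n) :
    Real.exp (n * Real.binEntropy (k / n)) ≤ (n + 1) * (n.choose k : ℝ) := by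
  have h1 := exp_entropy k n hn hk
  have h2 := binom_sum k n hn hk
  have h3 := Finset.sum_le_card_nsmul (Finset.range (n + 1)) (fun j => ((k : ℝ) / n) ^ j *
    (((n - k : ℕ) : ℝ) / n) ^ (n - j) * (n.choose j : ℝ)) _
    (fun j hj => term_le k n j hk (by have := Finset.mem_range.1 hj; omega))
  rw [h2] at h3
  set T := ((k : ℝ) / n) ^ k * (((n - k : ℕ) : ℝ) / n) ^ (n - k) with hT
  simp only [Finset.card_range, nsmul_eq_mul, Nat.cast_add, Nat.cast_one] at h3
  have hE := Real.exp_pos (n * Real.binEntropy ((k : ℝ) / n))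
  have := mul_le_mul_of_nonneg_left h3 hE.le
  calc _ ≤ _ := by simpa using this
    _ = (n + 1) * (n.choose k : ℝ) * (Real.exp (n * Real.binEntropy ((k : ℝ) / n)) * T) := by ring
    _ = _ := by rw [h1]; ring

def FPoly {p : ℕ} (J : (r : Fin p) → (Fin ((r : ℕ) + 1) → Fin p) → ℝ) (x : Fin p → ℝ) : ℝ :=
  ∑ r : Fin p, ∑ idx : Fin ((r : ℕ) + 1) → Fin p, J r idx * ∏ k, x (idx k)

/-- The up spins of a configuration, as a set of naturals. -/
def upSet (N : ℕ) (σ : Fin N → Bool) (A : Finset ℕ) : Finset ℕ :=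
  A.filter (fun i => ∃ hi : i < N, σ ⟨i, hi⟩ = true)

lemma groupMag_eq {p : ℕ} (P : ℕ → Fin p → Finset ℕ) (N : ℕ) (g : Fin p)
    (hsub : P N g ⊆ Finset.range N) (hc : 1 ≤ (P N g).card) (σ : Fin N → Bool) :
    groupMag P N g σ = 2 * (((upSet N σ (P N g)).card : ℝ) / ((P N g).card : ℝ)) - 1 := by
  have hc' : ((P N g).card : ℝ) ≠ 0 := by positivity
  have h : ∀ i ∈ P N g, spinAt N i σ =
      2 * (if (∃ hi : i < N, σ ⟨i, hi⟩ = true) then (1 : ℝ) else 0) - 1 := by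
    intro i hi
    have hiN := Finset.mem_range.1 (hsub hi)
    simp only [spinAt, hiN, dif_pos, spin, exists_true_left]
    split_ifs <;> norm_num
  rw [groupMag, Finset.sum_congr rfl h, Finset.sum_sub_distrib, ← Finset.mul_sum,
    Finset.sum_boole, upSet]
  simp
  field_simp

/-- The number of configurations with given up-spin counts. -/
lemma fiber_card {p : ℕ} (P : ℕ → Fin p → Finset ℕ) (N : ℕ)
    (hdisj : ∀ g k : Fin p, g ≠ k → Disjoint (P N g) (P N k))
    (hcover : Finset.univ.biUnion (P N) = Finset.range N) (k : Fin p → ℕ) :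
    (Finset.univ.filter
      (fun σ : Fin N → Bool => (fun g => (upSet N σ (P N g)).card) = k)).card =
      ∏ g, ((P N g).card.choose (k g)) := by
  have hsub : ∀ g, P N g ⊆ Finset.range N := fun g => by
    rw [← hcover]; exact Finset.subset_biUnion_of_mem _ (Finset.mem_univ g)
  have : ∏ g, ((P N g).card.choose (k g)) =
      (Fintype.piFinset (fun g => Finset.powersetCard (k g) (P N g))).card := by
    simp [Fintype.card_piFinset]
  rw [this]
  refine Finset.card_bij' (fun σ _ => fun g => upSet N σ (P N g))
    (fun A _ => fun i => decide (∃ g, (i : ℕ) ∈ A g)) ?_ ?_ ?_ ?_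
  · intro σ hσ
    simp only [Finset.mem_filter, Finset.mem_univ, true_and] at hσ
    simp only [Fintype.mem_piFinset, Finset.mem_powersetCard]
    intro g
    exact ⟨Finset.filter_subset _ _, congrFun hσ g⟩
  · intro A hA
    simp only [Fintype.mem_piFinset, Finset.mem_powersetCard] at hA
    simp only [Finset.mem_filter, Finset.mem_univ, true_and]
    funext g
    rw [← (hA g).2]
    congr 1
    ext i
    simp only [upSet, Finset.mem_filter, decide_eq_true_eq]
    constructor
    · rintro ⟨hi, _, g', hg'⟩
      by_cases hgg : g = g'
      · exact hgg ▸ hg'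
      · exact absurd ((hA g').1 hg') (Finset.disjoint_left.1 (hdisj g g' hgg) hi)
    · intro hi
      exact ⟨(hA g).1 hi, Finset.mem_range.1 (hsub g ((hA g).1 hi)), g, hi⟩
  · intro σ hσ
    funext i
    have : (∃ g, (i : ℕ) ∈ upSet N σ (P N g)) ↔ σ i = true := by
      simp only [upSet, Finset.mem_filter]
      constructor
      · rintro ⟨g, _, _, h⟩; exact h
      · intro h
        have : (i : ℕ) ∈ Finset.univ.biUnion (P N) := by
          rw [hcover]; exact Finset.mem_range.2 i.2
        obtain ⟨g, _, hg⟩ := Finset.mem_biUnion.1 this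
        exact ⟨g, hg, i.2, h⟩
    rw [Bool.eq_iff_iff]
    simpa using this
  · intro A hA
    simp only [Fintype.mem_piFinset, Finset.mem_powersetCard] at hA
    funext g
    ext i
    simp only [upSet, Finset.mem_filter, decide_eq_true_eq]
    constructor
    · rintro ⟨hi, _, g', hg'⟩
      by_cases hgg : g = g'
      · exact hgg ▸ hg'
      · exact absurd ((hA g').1 hg') (Finset.disjoint_left.1 (hdisj g g' hgg) hi)
    · intro hi
      exact ⟨(hA g).1 hi, Finset.mem_range.1 (hsub g ((hA g).1 hi)), g, hi⟩

/-- The finite-volume variational functional. -/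
def EFun {p : ℕ} (J : (r : Fin p) → (Fin ((r : ℕ) + 1) → Fin p) → ℝ) (a : Fin p → ℝ)
    (x : Fin p → ℝ) : ℝ :=
  FPoly J (fun g => 2 * x g - 1) + ∑ g, a g * Real.binEntropy (x g)

section bounds
variable {p : ℕ} (J : (r : Fin p) → (Fin ((r : ℕ) + 1) → Fin p) → ℝ)
    (P : ℕ → Fin p → Finset ℕ) (N : ℕ) (hN : 1 ≤ N)
    (hdisj : ∀ g k : Fin p, g ≠ k → Disjoint (P N g) (P N k))
    (hcover : Finset.univ.biUnion (P N) = Finset.range N)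
    (hcard : ∀ g, 1 ≤ (P N g).card)

include hcover in
lemma part_sub (g : Fin p) : P N g ⊆ Finset.range N := by
  rw [← hcover]; exact Finset.subset_biUnion_of_mem _ (Finset.mem_univ g)

include hcover in
lemma part_card_le (g : Fin p) : (P N g).card ≤ N := by
  simpa using Finset.card_le_card (part_sub P N hcover g)

include hdisj hcover hcard in
lemma Z_eq : ∑ σ : Fin N → Bool, Real.exp (-hamMulti J P N σ) =
    ∑ k ∈ Fintype.piFinset (fun g => Finset.range ((P N g).card + 1)),
      (∏ g, ((P N g).card.choose (k g) : ℝ)) *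
        Real.exp (N * FPoly J (fun g => 2 * ((k g : ℝ) / ((P N g).card : ℝ)) - 1)) := by
  rw [← Finset.sum_fiberwise_of_maps_to
    (t := Fintype.piFinset (fun g => Finset.range ((P N g).card + 1)))
    (g := fun σ => (fun g => (upSet N σ (P N g)).card))]
  · refine Finset.sum_congr rfl fun k _ => ?_
    have : ∀ σ ∈ Finset.univ.filter
      (fun σ : Fin N → Bool => (fun g => (upSet N σ (P N g)).card) = k),
      Real.exp (-hamMulti J P N σ) =
        Real.exp (N * FPoly J (fun g => 2 * ((k g : ℝ) / ((P N g).card : ℝ)) - 1)) := by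
      intro σ hσ
      simp only [Finset.mem_filter, Finset.mem_univ, true_and] at hσ
      subst hσ
      rw [hamMulti, neg_neg, FPoly]
      simp only [fun g => groupMag_eq P N g (part_sub P N hcover g) (hcard g) σ]
    rw [Finset.sum_congr rfl this, Finset.sum_const, fiber_card P N hdisj hcover, nsmul_eq_mul]
    push_cast
    rfl
  · intro σ _
    simp only [Fintype.mem_piFinset, Finset.mem_range, Nat.lt_succ_iff]
    intro g
    exact Finset.card_le_card (Finset.filter_subset _ _)

include hN in
lemma exp_EFun (x : Fin p → ℝ) :
    Real.exp (N * EFun J (fun g => ((P N g).card : ℝ) / N) x) =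
    (∏ g, Real.exp (((P N g).card : ℝ) * Real.binEntropy (x g))) *
      Real.exp (N * FPoly J (fun g => 2 * x g - 1)) := by
  have hN' : (N : ℝ) ≠ 0 := by positivity
  rw [← Real.exp_sum, ← Real.exp_add, EFun, mul_add, Finset.mul_sum, add_comm]
  congr 2
  refine Finset.sum_congr rfl fun g _ => ?_
  field_simp

include hN hdisj hcover hcard in
lemma pressure_upper (B : ℝ)
    (hB : ∀ x : Fin p → ℝ, (∀ g, x g ∈ Set.Icc (0 : ℝ) 1) →
      EFun J (fun g => ((P N g).card : ℝ) / N) x ≤ B) :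
    pressureMulti J P N ≤ B + p * (Real.log (N + 1) / N) := by
  have hN' : (0 : ℝ) < N := by positivity
  have hZ : ∑ σ : Fin N → Bool, Real.exp (-hamMulti J P N σ) ≤
      ((N : ℝ) + 1) ^ p * Real.exp (N * B) := by
    rw [Z_eq J P N hdisj hcover hcard]
    have h1 : ∀ k ∈ Fintype.piFinset (fun g => Finset.range ((P N g).card + 1)),
      (∏ g, ((P N g).card.choose (k g) : ℝ)) *
        Real.exp (N * FPoly J (fun g => 2 * ((k g : ℝ) / ((P N g).card : ℝ)) - 1)) ≤
        Real.exp (N * B) := by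
      intro k hk
      simp only [Fintype.mem_piFinset, Finset.mem_range, Nat.lt_succ_iff] at hk
      have h2 := hB (fun g => (k g : ℝ) / ((P N g).card : ℝ)) (fun g => by
        constructor
        · positivity
        · exact div_le_one_of_le₀ (by exact_mod_cast hk g) (by positivity))
      refine le_trans ?_ (Real.exp_le_exp.2 (mul_le_mul_of_nonneg_left h2 hN'.le))
      rw [exp_EFun J P N hN]
      refine mul_le_mul_of_nonneg_right ?_ (Real.exp_pos _).le
      exact Finset.prod_le_prod (fun g _ => by positivity)
        (fun g _ => choose_upper _ _ (hcard g) (hk g))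
    refine (Finset.sum_le_card_nsmul _ _ _ h1).trans ?_
    rw [nsmul_eq_mul]
    refine mul_le_mul_of_nonneg_right ?_ (Real.exp_pos _).le
    rw [Fintype.card_piFinset]
    simp only [Finset.card_range]
    push_cast
    calc _ ≤ ∏ _g : Fin p, ((N : ℝ) + 1) := Finset.prod_le_prod (fun g _ => by positivity)
            (fun g _ => by have := part_card_le P N hcover g; gcongr)
      _ = _ := by simp
  have hZpos : 0 < ∑ σ : Fin N → Bool, Real.exp (-hamMulti J P N σ) :=
    Finset.sum_pos (fun _ _ => Real.exp_pos _) Finset.univ_nonempty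
  have h3 := Real.log_le_log hZpos hZ
  rw [Real.log_mul (by positivity) (by positivity), Real.log_pow, Real.log_exp] at h3
  rw [pressureMulti, div_le_iff₀ hN']
  refine h3.trans (le_of_eq ?_)
  field_simp
  ring

include hN hdisj hcover hcard in
lemma pressure_lower (k : Fin p → ℕ) (hk : ∀ g, k g ≤ (P N g).card) :
    EFun J (fun g => ((P N g).card : ℝ) / N) (fun g => (k g : ℝ) / ((P N g).card : ℝ))
      - p * (Real.log (N + 1) / N) ≤ pressureMulti J P N := by
  have hN' : (0 : ℝ) < N := by positivity
  set Z := ∑ σ : Fin N → Bool, Real.exp (-hamMulti J P N σ) with hZdef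
  have hZpos : 0 < Z :=
    Finset.sum_pos (fun _ _ => Real.exp_pos _) Finset.univ_nonempty
  have hZ : Real.exp (N * EFun J (fun g => ((P N g).card : ℝ) / N)
      (fun g => (k g : ℝ) / ((P N g).card : ℝ))) ≤ ((N : ℝ) + 1) ^ p * Z := by
    rw [exp_EFun J P N hN, hZdef, Z_eq J P N hdisj hcover hcard]
    have h1 := Finset.single_le_sum
      (s := Fintype.piFinset (fun g => Finset.range ((P N g).card + 1)))
      (f := fun k : Fin p → ℕ => (∏ g, ((P N g).card.choose (k g) : ℝ)) *
        Real.exp (N * FPoly J (fun g => 2 * ((k g : ℝ) / ((P N g).card : ℝ)) - 1)))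
      (fun k _ => by positivity) (a := k)
      (by simpa only [Fintype.mem_piFinset, Finset.mem_range, Nat.lt_succ_iff] using hk)
    refine le_trans ?_ (mul_le_mul_of_nonneg_left h1 (by positivity))
    rw [← mul_assoc]
    refine mul_le_mul_of_nonneg_right ?_ (Real.exp_pos _).le
    calc _ ≤ ∏ g : Fin p, (((N : ℝ) + 1) * ((P N g).card.choose (k g) : ℝ)) :=
            Finset.prod_le_prod (fun g _ => by positivity)
            (fun g _ => by
              refine (choose_lower _ _ (hcard g) (hk g)).trans ?_
              have := part_card_le P N hcover g
              gcongr)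
      _ = _ := by rw [Finset.prod_mul_distrib]; simp
  have h3 := Real.log_le_log (Real.exp_pos _) hZ
  rw [Real.log_mul (by positivity) hZpos.ne', Real.log_pow, Real.log_exp] at h3
  rw [pressureMulti, le_div_iff₀ hN', sub_mul, ← hZdef]
  have : (p : ℝ) * (Real.log (N + 1) / N) * N = p * Real.log (N + 1) := by field_simp
  rw [this]
  linarith
end bounds

lemma EFun_continuous {p : ℕ} (J : (r : Fin p) → (Fin ((r : ℕ) + 1) → Fin p) → ℝ) :
    Continuous (fun y : (Fin p → ℝ) × (Fin p → ℝ) => EFun J y.1 y.2) := by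
  unfold EFun FPoly
  have := Real.binEntropy_continuous
  fun_prop

/-- Existence of the thermodynamic limit for the `p`-population mean field model with
`r`-body interactions: the pressures per particle converge to a finite limit. -/
theorem multiPopulation_thermodynamic_limit (p : ℕ) (hp : 1 ≤ p)
    (α : Fin p → ℝ) (hα : ∀ g, α g ∈ Set.Ioo (0 : ℝ) 1) (hαsum : ∑ g, α g = 1)
    (J : (r : Fin p) → (Fin ((r : ℕ) + 1) → Fin p) → ℝ)
    (P : ℕ → Fin p → Finset ℕ)
    (hdisj : ∀ N, ∀ g k : Fin p, g ≠ k → Disjoint (P N g) (P N k))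
    (hcover : ∀ N, p ≤ N → Finset.univ.biUnion (P N) = Finset.range N)
    (hcard : ∀ N, p ≤ N → ∀ g, 1 ≤ (P N g).card)
    (hfrac : ∀ g, Tendsto (fun N : ℕ => ((P N g).card : ℝ) / N) atTop (nhds (α g))) :
    ∃ L : ℝ, Tendsto (fun N : ℕ => pressureMulti J P N) atTop (nhds L) := by
  -- the maximizer of the limiting functional
  have hcont := EFun_continuous J
  have hcontα : Continuous (EFun J α) := by
    have h0 : Continuous (fun y : Fin p → ℝ => (α, y)) := continuous_const.prodMk continuous_id
    have h1 := hcont.comp h0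
    exact h1
  obtain ⟨x, hxmem, hxmax⟩ := (isCompact_univ_pi
    (fun _ : Fin p => isCompact_Icc (a := (0 : ℝ)) (b := 1))).exists_isMaxOn
    ⟨fun _ => 0, fun _ _ => ⟨le_rfl, zero_le_one⟩⟩ hcontα.continuousOn
  have hx : ∀ g, x g ∈ Set.Icc (0 : ℝ) 1 := fun g => hxmem g (Set.mem_univ g)
  refine ⟨EFun J α x, ?_⟩
  have hlog : Tendsto (fun N : ℕ => (p : ℝ) * (Real.log (N + 1) / N)) atTop (nhds 0) := by
    have h1 : Tendsto (fun y : ℝ => Real.log y / y) atTop (nhds 0) := by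
      simpa using Real.isLittleO_log_id_atTop.tendsto_div_nhds_zero
    have h2 : Tendsto (fun N : ℕ => Real.log ((N : ℝ) + 1) / ((N : ℝ) + 1)) atTop (nhds 0) :=
      h1.comp (tendsto_atTop_add_const_right atTop (1 : ℝ) (tendsto_natCast_atTop_atTop (R := ℝ)))
    have h3 : Tendsto (fun N : ℕ => 1 + 1 / (N : ℝ)) atTop (nhds 1) := by
      simpa using (tendsto_const_div_atTop_nhds_zero_nat (1 : ℝ)).const_add 1
    have h4 := (h2.mul h3).const_mul (p : ℝ)
    simp only [zero_mul, mul_zero] at h4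
    refine h4.congr' ?_
    filter_upwards [eventually_ge_atTop 1] with N hN
    have : (N : ℝ) ≠ 0 := by positivity
    field_simp
  have hcardtop : ∀ g, Tendsto (fun N : ℕ => ((P N g).card : ℝ)) atTop atTop := by
    intro g
    have h := (hfrac g).pos_mul_atTop (hα g).1 (tendsto_natCast_atTop_atTop (R := ℝ))
    refine h.congr' ?_
    filter_upwards [eventually_ge_atTop 1] with N hN
    have : (N : ℝ) ≠ 0 := by positivity
    field_simp
  have hfr : Tendsto (fun N : ℕ => fun g => ((P N g).card : ℝ) / N) atTop (nhds α) :=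
    tendsto_pi_nhds.2 hfrac
  have hlow : Tendsto (fun N : ℕ => EFun J (fun g => ((P N g).card : ℝ) / N)
      (fun g => ((⌊x g * ((P N g).card : ℝ)⌋₊ : ℕ) : ℝ) / ((P N g).card : ℝ))
      - p * (Real.log (N + 1) / N)) atTop (nhds (EFun J α x)) := by
    have hk : Tendsto (fun N : ℕ => fun g =>
        ((⌊x g * ((P N g).card : ℝ)⌋₊ : ℕ) : ℝ) / ((P N g).card : ℝ)) atTop (nhds x) :=
      tendsto_pi_nhds.2 fun g => (tendsto_nat_floor_mul_div_atTop (hx g).1).comp (hcardtop g)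
    have := ((hcont.tendsto (α, x)).comp (hfr.prodMk_nhds hk)).sub hlog
    simpa using this
  have hup : Tendsto (fun N : ℕ => (EFun J α x +
      ∑ g, |((P N g).card : ℝ) / N - α g| * Real.log 2) + p * (Real.log (N + 1) / N))
      atTop (nhds (EFun J α x)) := by
    have h1 : Tendsto (fun N : ℕ => ∑ g, |((P N g).card : ℝ) / N - α g| * Real.log 2)
        atTop (nhds (∑ g : Fin p, |α g - α g| * Real.log 2)) :=
      tendsto_finsetSum _ fun g _ => (((hfrac g).sub_const (α g)).abs).mul_const _
    have := (h1.const_add (EFun J α x)).add hlog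
    simpa using this
  refine tendsto_of_tendsto_of_tendsto_of_le_of_le' hlow hup ?_ ?_
  · filter_upwards [eventually_ge_atTop p] with N hN
    refine pressure_lower J P N (hp.trans hN) (hdisj N) (hcover N hN) (hcard N hN) _ ?_
    intro g
    refine Nat.floor_le_of_le ?_
    exact mul_le_of_le_one_left (by positivity) (hx g).2
  · filter_upwards [eventually_ge_atTop p] with N hN
    refine pressure_upper J P N (hp.trans hN) (hdisj N) (hcover N hN) (hcard N hN) _ ?_
    intro y hy
    have h1 : EFun J α y ≤ EFun J α x := hxmax (fun g _ => hy g)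
    have h2 : EFun J (fun g => ((P N g).card : ℝ) / N) y - EFun J α y ≤
        ∑ g, |((P N g).card : ℝ) / N - α g| * Real.log 2 := by
      simp only [EFun, add_sub_add_left_eq_sub]
      rw [← Finset.sum_sub_distrib]
      refine Finset.sum_le_sum fun g _ => ?_
      rw [← sub_mul]
      exact mul_le_mul (le_abs_self _) Real.binEntropy_le_log_two
        (Real.binEntropy_nonneg (hy g).1 (hy g).2) (abs_nonneg _)
    linarith
end
end

section
/- Variational lower bound for the multi-population pressure: with the notation of the multi-population Curie-Weiss model with pair interactions, for all couplings J_{gk} ∈ ℝ and fields h_g ∈ ℝ, liminf_{N→∞} p_N ≥ sup_{m̄∈(−1,1)^p} p_LOW(m̄), where p_LOW(m̄) = (1/2)·Σ_{g,k=1}^p J_{gk}·m̄_g·m̄_k + Σ_{g=1}^p h_g·m̄_g + Σ_{g=1}^p α_g·S(m̄_g) and S(x) = −((1+x)/2)·ln((1+x)/2) − ((1−x)/2)·ln((1−x)/2). -/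
open Filter

noncomputable section

/-- Hamiltonian of the multi-population Curie-Weiss model with pair interactions. -/
def hamPair {p : ℕ} (J : Fin p → Fin p → ℝ) (h : Fin p → ℝ)
    (P : ℕ → Fin p → Finset ℕ) (N : ℕ) (σ : Fin N → Bool) : ℝ :=
  -(N * (1 / 2 * ∑ g, ∑ k, J g k * groupMag P N g σ * groupMag P N k σ
      + ∑ g, h g * groupMag P N g σ))

/-- Pressure per particle of the multi-population model. -/
def pressurePair {p : ℕ} (J : Fin p → Fin p → ℝ) (h : Fin p → ℝ)
    (P : ℕ → Fin p → Finset ℕ) (N : ℕ) : ℝ :=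
  Real.log (∑ σ : Fin N → Bool, Real.exp (-hamPair J h P N σ)) / N

/-- The lower-bound variational functional `p_LOW` of the multi-population model. -/
def pLOW {p : ℕ} (α : Fin p → ℝ) (J : Fin p → Fin p → ℝ) (h : Fin p → ℝ)
    (m : Fin p → ℝ) : ℝ :=
  1 / 2 * ∑ g, ∑ k, J g k * m g * m k + ∑ g, h g * m g + ∑ g, α g * binEnt (m g)

/-- Expectation with respect to the product measure with means `x`. -/
def pw (N : ℕ) (x : ℕ → ℝ) (σ : Fin N → Bool) : ℝ :=
  ∏ i : Fin N, (1 + x i * spin (σ i)) / 2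

def pE (N : ℕ) (x : ℕ → ℝ) (φ : (Fin N → Bool) → ℝ) : ℝ :=
  ∑ σ : Fin N → Bool, pw N x σ * φ σ

lemma pE_prod (N : ℕ) (x : ℕ → ℝ) (F : Fin N → Bool → ℝ) :
    pE N x (fun σ => ∏ i, F i (σ i)) =
      ∏ i : Fin N, ((1 + x i) / 2 * F i true + (1 - x i) / 2 * F i false) := by
  unfold pE pw
  simp_rw [← Finset.prod_mul_distrib]
  have := Finset.prod_univ_sum (fun _ : Fin N => (Finset.univ : Finset Bool))
    (fun i b => (1 + x i * spin b) / 2 * F i b)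
  rw [Fintype.piFinset_univ] at this
  rw [← this]
  apply Finset.prod_congr rfl
  intro i _
  rw [Fintype.sum_bool]
  simp only [spin, if_true, Bool.false_eq_true, if_false]
  ring

lemma pE_one (N : ℕ) (x : ℕ → ℝ) : pE N x (fun _ => 1) = 1 := by
  have := pE_prod N x (fun _ _ => 1)
  simp only [Finset.prod_const_one] at this
  rw [this]
  apply Finset.prod_eq_one
  intro i _
  ring

lemma pE_spin (N : ℕ) (x : ℕ → ℝ) (i : Fin N) : pE N x (fun σ => spin (σ i)) = x i := by
  have := pE_prod N x (fun k b => if k = i then spin b else 1)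
  simp only [Finset.prod_ite_eq', Finset.mem_univ, if_true] at this
  rw [this, Finset.prod_eq_single i]
  · simp [spin]; ring
  · intro k _ hk
    simp [hk]; ring
  · simp

lemma pE_spin2 (N : ℕ) (x : ℕ → ℝ) (i j : Fin N) (hij : i ≠ j) :
    pE N x (fun σ => spin (σ i) * spin (σ j)) = x i * x j := by
  have := pE_prod N x (fun k b => (if k = i then spin b else 1) * (if k = j then spin b else 1))
  simp only [Finset.prod_mul_distrib, Finset.prod_ite_eq', Finset.mem_univ, if_true] at this
  rw [this]
  have h2 : ∀ k : Fin N, ((1 + x k) / 2 * ((if k = i then spin true else 1) * (if k = j then spin true else 1))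
      + (1 - x k) / 2 * ((if k = i then spin false else 1) * (if k = j then spin false else 1)))
      = (if k = i then x k else 1) * (if k = j then x k else 1) := by
    intro k
    by_cases h1 : k = i
    · have : k ≠ j := fun h => hij (h1 ▸ h)
      simp [h1, hij, spin]; ring
    · by_cases h3 : k = j
      · simp [h3, hij.symm, spin]; ring
      · simp [h1, h3]; ring
  simp_rw [h2]
  simp only [Finset.prod_mul_distrib, Finset.prod_ite_eq', Finset.mem_univ, if_true]

lemma pE_add (N : ℕ) (x : ℕ → ℝ) (φ ψ : (Fin N → Bool) → ℝ) :
    pE N x (fun σ => φ σ + ψ σ) = pE N x φ + pE N x ψ := by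
  simp [pE, mul_add, Finset.sum_add_distrib]

lemma pE_mul (N : ℕ) (x : ℕ → ℝ) (c : ℝ) (φ : (Fin N → Bool) → ℝ) :
    pE N x (fun σ => c * φ σ) = c * pE N x φ := by
  simp only [pE, Finset.mul_sum]
  exact Finset.sum_congr rfl fun _ _ => by ring

lemma pE_sum {ι : Type*} (N : ℕ) (x : ℕ → ℝ) (s : Finset ι) (φ : ι → (Fin N → Bool) → ℝ) :
    pE N x (fun σ => ∑ i ∈ s, φ i σ) = ∑ i ∈ s, pE N x (φ i) := by
  simp only [pE, Finset.mul_sum]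
  exact Finset.sum_comm

lemma pE_const (N : ℕ) (x : ℕ → ℝ) (c : ℝ) : pE N x (fun _ => c) = c := by
  have := pE_mul N x c (fun _ => 1)
  rw [pE_one] at this
  simpa using this

lemma pE_spinAt (N : ℕ) (x : ℕ → ℝ) (i : ℕ) (hi : i < N) :
    pE N x (fun σ => spinAt N i σ) = x i := by
  simp only [spinAt, hi, dif_pos]
  exact pE_spin N x ⟨i, hi⟩

lemma spin_sq (b : Bool) : spin b * spin b = 1 := by cases b <;> simp [spin]

lemma pE_spinAt2 (N : ℕ) (x : ℕ → ℝ) (i j : ℕ) (hi : i < N) (hj : j < N) :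
    pE N x (fun σ => spinAt N i σ * spinAt N j σ) = x i * x j + if i = j then 1 - x i ^ 2 else 0 := by
  simp only [spinAt, hi, hj, dif_pos]
  by_cases h : i = j
  · subst h
    simp only [spin_sq, pE_one, if_true]
    ring
  · rw [pE_spin2 N x ⟨i, hi⟩ ⟨j, hj⟩ (by simpa using h)]
    simp [h]

lemma pE_log (N : ℕ) (x : ℕ → ℝ) (hx : ∀ i, x i ∈ Set.Ioo (-1 : ℝ) 1) :
    pE N x (fun σ => Real.log (pw N x σ)) = -∑ i : Fin N, binEnt (x i) := by
  have h1 : ∀ σ : Fin N → Bool, Real.log (pw N x σ) = ∑ i : Fin N,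
      ((Real.log ((1 + x i) / 2) + Real.log ((1 - x i) / 2)) / 2
       + (Real.log ((1 + x i) / 2) - Real.log ((1 - x i) / 2)) / 2 * spin (σ i)) := by
    intro σ
    unfold pw
    rw [Real.log_prod]
    · apply Finset.sum_congr rfl
      intro i _
      cases σ i
      · simp [spin, ← sub_eq_add_neg]; ring
      · simp [spin]; ring
    · intro i _
      have := hx i
      rcases this with ⟨ha, hb⟩
      cases σ i <;> simp [spin] <;> linarith
  simp_rw [h1]
  rw [pE_sum, ← Finset.sum_neg_distrib]
  apply Finset.sum_congr rfl
  intro i _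
  rw [pE_add, pE_const, pE_mul, pE_spin]
  unfold binEnt
  ring

lemma pw_pos (N : ℕ) (x : ℕ → ℝ) (hx : ∀ i, x i ∈ Set.Ioo (-1 : ℝ) 1) (σ : Fin N → Bool) :
    0 < pw N x σ := by
  apply Finset.prod_pos
  intro i _
  rcases hx i with ⟨ha, hb⟩
  cases σ i <;> simp [spin] <;> linarith

lemma gibbs (N : ℕ) (x : ℕ → ℝ) (hx : ∀ i, x i ∈ Set.Ioo (-1 : ℝ) 1)
    (H : (Fin N → Bool) → ℝ) :
    pE N x H + ∑ i : Fin N, binEnt (x i) ≤ Real.log (∑ σ : Fin N → Bool, Real.exp (H σ)) := by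
  have hJ := convexOn_exp.map_sum_le (t := Finset.univ) (w := pw N x)
    (p := fun σ => H σ + (-1) * Real.log (pw N x σ))
    (fun σ _ => (pw_pos N x hx σ).le) (by simpa [pE] using pE_one N x) (fun _ _ => Set.mem_univ _)
  simp only [smul_eq_mul] at hJ
  have e1 : ∑ σ, pw N x σ * (H σ + (-1) * Real.log (pw N x σ))
      = pE N x H + ∑ i : Fin N, binEnt (x i) := by
    change pE N x (fun σ => H σ + (-1) * Real.log (pw N x σ)) = _
    rw [pE_add, pE_mul, pE_log N x hx]
    ring
  have e2 : ∑ σ, pw N x σ * Real.exp (H σ + (-1) * Real.log (pw N x σ))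
      = ∑ σ, Real.exp (H σ) := by
    apply Finset.sum_congr rfl
    intro σ _
    have := pw_pos N x hx σ
    rw [Real.exp_add, neg_one_mul, Real.exp_neg, Real.exp_log this]
    field_simp
  rw [e1, e2] at hJ
  rw [Real.le_log_iff_exp_le (lt_of_lt_of_le (Real.exp_pos _) hJ)]
  exact hJ

lemma pE_mag {p : ℕ} (P : ℕ → Fin p → Finset ℕ) (N : ℕ) (x : ℕ → ℝ) (m : Fin p → ℝ)
    (hlt : ∀ g, ∀ i ∈ P N g, i < N) (hx : ∀ g, ∀ i ∈ P N g, x i = m g)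
    (hc : ∀ g, 1 ≤ (P N g).card) (g : Fin p) :
    pE N x (groupMag P N g) = m g := by
  have hc' : ((P N g).card : ℝ) ≠ 0 := by have := hc g; positivity
  have : groupMag P N g = fun σ => ((P N g).card : ℝ)⁻¹ * ∑ i ∈ P N g, spinAt N i σ := by
    funext σ; unfold groupMag; ring
  rw [this, pE_mul, pE_sum, Finset.sum_congr rfl
    (fun i hi => (pE_spinAt N x i (hlt g i hi)).trans (hx g i hi))]
  simp
  field_simp

lemma pE_mag2 {p : ℕ} (P : ℕ → Fin p → Finset ℕ) (N : ℕ) (x : ℕ → ℝ) (m : Fin p → ℝ)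
    (hdisj : ∀ g k : Fin p, g ≠ k → Disjoint (P N g) (P N k))
    (hlt : ∀ g, ∀ i ∈ P N g, i < N) (hx : ∀ g, ∀ i ∈ P N g, x i = m g)
    (hc : ∀ g, 1 ≤ (P N g).card) (g k : Fin p) :
    pE N x (fun σ => groupMag P N g σ * groupMag P N k σ) =
      m g * m k + if g = k then (1 - m g ^ 2) * ((P N g).card : ℝ)⁻¹ else 0 := by
  have hg' : ((P N g).card : ℝ) ≠ 0 := by have := hc g; positivity
  have hk' : ((P N k).card : ℝ) ≠ 0 := by have := hc k; positivity
  have : (fun σ => groupMag P N g σ * groupMag P N k σ) =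
      fun σ => (((P N g).card : ℝ)⁻¹ * ((P N k).card : ℝ)⁻¹) *
        ∑ i ∈ P N g, ∑ j ∈ P N k, spinAt N i σ * spinAt N j σ := by
    funext σ; unfold groupMag; rw [← Finset.sum_mul_sum]; ring
  rw [this, pE_mul, pE_sum]
  have e : ∀ i ∈ P N g, pE N x (fun σ => ∑ j ∈ P N k, spinAt N i σ * spinAt N j σ)
      = (P N k).card * (m g * m k) + if g = k then 1 - m g ^ 2 else 0 := by
    intro i hi
    rw [pE_sum, Finset.sum_congr rfl
      (fun j hj => (pE_spinAt2 N x i j (hlt g i hi) (hlt k j hj)).trans (by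
        rw [hx g i hi, hx k j hj]))]
    rw [Finset.sum_add_distrib, Finset.sum_ite_eq]
    have : i ∈ P N k ↔ g = k := by
      constructor
      · intro h
        by_contra hne
        exact Finset.disjoint_left.1 (hdisj g k hne) hi h
      · rintro rfl; exact hi
    simp [this]
  rw [Finset.sum_congr rfl e]
  by_cases hgk : g = k
  · subst hgk
    simp
    field_simp
  · simp [hgk]
    field_simp

lemma press_lower {p : ℕ} (J : Fin p → Fin p → ℝ) (h : Fin p → ℝ)
    (P : ℕ → Fin p → Finset ℕ) (N : ℕ) (hN : 1 ≤ N) (m : Fin p → ℝ)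
    (hm : ∀ g, m g ∈ Set.Ioo (-1 : ℝ) 1)
    (hdisj : ∀ g k : Fin p, g ≠ k → Disjoint (P N g) (P N k))
    (hcover : Finset.univ.biUnion (P N) = Finset.range N)
    (hc : ∀ g, 1 ≤ (P N g).card) :
    1 / 2 * ∑ g, ∑ k, J g k * (m g * m k + if g = k then (1 - m g ^ 2) * ((P N g).card : ℝ)⁻¹ else 0)
      + ∑ g, h g * m g + ∑ g, ((P N g).card : ℝ) / N * binEnt (m g) ≤ pressurePair J h P N := by
  classical
  have hlt : ∀ g, ∀ i ∈ P N g, i < N := by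
    intro g i hi
    rw [← Finset.mem_range, ← hcover]
    exact Finset.mem_biUnion.2 ⟨g, Finset.mem_univ _, hi⟩
  let x : ℕ → ℝ := fun i => if hi : ∃ g, i ∈ P N g then m hi.choose else 0
  have hx : ∀ g, ∀ i ∈ P N g, x i = m g := by
    intro g i hi
    have hex : ∃ g, i ∈ P N g := ⟨g, hi⟩
    simp only [x, dif_pos hex]
    congr 1
    by_contra hne
    exact Finset.disjoint_left.1 (hdisj _ _ hne) hex.choose_spec hi
  have hxI : ∀ i, x i ∈ Set.Ioo (-1 : ℝ) 1 := by
    intro i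
    simp only [x]
    split_ifs
    · exact hm _
    · norm_num
  have hG := gibbs N x hxI (fun σ => -hamPair J h P N σ)
  have e1 : ∑ i : Fin N, binEnt (x i) = ∑ g, ((P N g).card : ℝ) * binEnt (m g) := by
    rw [← Finset.sum_range (fun i => binEnt (x i)), ← hcover, Finset.sum_biUnion]
    · apply Finset.sum_congr rfl
      intro g _
      rw [Finset.sum_congr rfl (fun i hi => by rw [hx g i hi])]
      simp
    · intro a _ b _ hab
      exact hdisj a b hab
  have e2 : pE N x (fun σ => -hamPair J h P N σ) = N * (1 / 2 * ∑ g, ∑ k, J g k *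
      (m g * m k + if g = k then (1 - m g ^ 2) * ((P N g).card : ℝ)⁻¹ else 0) + ∑ g, h g * m g) := by
    simp only [hamPair, neg_neg, mul_assoc (J _ _)]
    rw [pE_mul, pE_add, pE_mul, pE_sum, pE_sum]
    simp_rw [pE_sum, pE_mul, pE_mag2 P N x m hdisj hlt hx hc]
    congr 2
    exact Finset.sum_congr rfl fun g _ => by
      rw [← pE_mag P N x m hlt hx hc g]
  rw [e1, e2] at hG
  have hN' : (0 : ℝ) < N := by exact_mod_cast hN
  unfold pressurePair
  rw [le_div_iff₀ hN']
  refine le_trans (le_of_eq ?_) hG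
  rw [add_mul, mul_comm _ (N : ℝ), Finset.sum_mul]
  congr 1
  apply Finset.sum_congr rfl
  intro g _
  field_simp

lemma abs_spinAt_le (N i : ℕ) (σ : Fin N → Bool) : |spinAt N i σ| ≤ 1 := by
  unfold spinAt
  split_ifs with hi
  · cases σ ⟨i, hi⟩ <;> simp [spin]
  · simp

lemma abs_mag_le {p : ℕ} (P : ℕ → Fin p → Finset ℕ) (N : ℕ) (g : Fin p) (σ : Fin N → Bool) :
    |groupMag P N g σ| ≤ 1 := by
  unfold groupMag
  rw [abs_div, Nat.abs_cast]
  apply div_le_one_of_le₀ _ (by positivity)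
  refine (Finset.abs_sum_le_sum_abs _ _).trans ?_
  refine (Finset.sum_le_sum (fun i _ => abs_spinAt_le N i σ)).trans ?_
  simp

lemma press_upper {p : ℕ} (J : Fin p → Fin p → ℝ) (h : Fin p → ℝ)
    (P : ℕ → Fin p → Finset ℕ) (N : ℕ) (hN : 1 ≤ N) :
    pressurePair J h P N ≤ Real.log 2 + (1 / 2 * ∑ g, ∑ k, |J g k| + ∑ g, |h g|) := by
  have hN' : (0 : ℝ) < N := by exact_mod_cast hN
  set C := (1 / 2 * ∑ g, ∑ k, |J g k| + ∑ g, |h g|) with hC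
  have hb : ∀ σ, -hamPair J h P N σ ≤ N * C := by
    intro σ
    simp only [hamPair, neg_neg]
    apply mul_le_mul_of_nonneg_left _ hN'.le
    rw [hC]
    gcongr with g _ k _ g _
    · refine (le_abs_self _).trans ?_
      rw [abs_mul, abs_mul, mul_assoc]
      have h1 := abs_mag_le P N g σ
      have h2 := abs_mag_le P N k σ
      exact mul_le_of_le_one_right (abs_nonneg _) (mul_le_one₀ h1 (abs_nonneg _) h2)
    · refine (le_abs_self _).trans ?_
      rw [abs_mul]
      exact mul_le_of_le_one_right (abs_nonneg _) (abs_mag_le P N g σ)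
  have hZ : ∑ σ : Fin N → Bool, Real.exp (-hamPair J h P N σ) ≤ 2 ^ N * Real.exp (N * C) := by
    refine (Finset.sum_le_sum (fun σ _ => Real.exp_le_exp.2 (hb σ))).trans ?_
    simp
  unfold pressurePair
  rw [div_le_iff₀ hN']
  refine (Real.log_le_log (Finset.sum_pos (fun _ _ => Real.exp_pos _) Finset.univ_nonempty) hZ).trans ?_
  rw [Real.log_mul (by positivity) (by positivity), Real.log_exp, Real.log_pow]
  apply le_of_eq
  ring

/-- Variational lower bound for the multi-population pressure:
`liminf_{N→∞} p_N ≥ sup_{m̄ ∈ (−1,1)^p} p_LOW(m̄)`. -/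
theorem multiPopulation_pressure_lower_bound (p : ℕ) (hp : 1 ≤ p)
    (α : Fin p → ℝ) (hα : ∀ g, α g ∈ Set.Ioo (0 : ℝ) 1) (hαsum : ∑ g, α g = 1)
    (J : Fin p → Fin p → ℝ) (h : Fin p → ℝ)
    (P : ℕ → Fin p → Finset ℕ)
    (hdisj : ∀ N, ∀ g k : Fin p, g ≠ k → Disjoint (P N g) (P N k))
    (hcover : ∀ N, p ≤ N → Finset.univ.biUnion (P N) = Finset.range N)
    (hcard : ∀ N, p ≤ N → ∀ g, 1 ≤ (P N g).card)
    (hfrac : ∀ g, Tendsto (fun N : ℕ => ((P N g).card : ℝ) / N) atTop (nhds (α g))) :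
    sSup (pLOW α J h '' Set.univ.pi fun _ : Fin p => Set.Ioo (-1 : ℝ) 1) ≤
      liminf (fun N : ℕ => pressurePair J h P N) atTop := by
  apply csSup_le
  · exact ⟨_, ⟨fun _ => 0, by intro g _; norm_num, rfl⟩⟩
  rintro _ ⟨m, hm, rfl⟩
  have hm' : ∀ g, m g ∈ Set.Ioo (-1 : ℝ) 1 := fun g => hm g (Set.mem_univ _)
  have hinv : ∀ g, Tendsto (fun N : ℕ => ((P N g).card : ℝ)⁻¹) atTop (nhds 0) := by
    intro g
    have h1 := ((hfrac g).inv₀ (hα g).1.ne').mul (tendsto_inv_atTop_nhds_zero_nat (𝕜 := ℝ))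
    rw [mul_zero] at h1
    refine h1.congr' ?_
    filter_upwards [eventually_ge_atTop 1] with N hN
    have : (N : ℝ) ≠ 0 := by positivity
    rw [inv_div, div_mul_eq_mul_div, mul_inv_cancel₀ this, one_div]
  have hlim : Tendsto (fun N : ℕ =>
      1 / 2 * ∑ g, ∑ k, J g k * (m g * m k + if g = k then (1 - m g ^ 2) * ((P N g).card : ℝ)⁻¹ else 0)
      + ∑ g, h g * m g + ∑ g, ((P N g).card : ℝ) / N * binEnt (m g)) atTop
      (nhds (pLOW α J h m)) := by
    unfold pLOW
    refine Tendsto.add (Tendsto.add (Tendsto.const_mul _ ?_) tendsto_const_nhds) ?_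
    · refine tendsto_finsetSum _ fun g _ => tendsto_finsetSum _ fun k _ => ?_
      rw [mul_assoc]
      apply Tendsto.const_mul
      split_ifs
      · simpa using ((hinv g).const_mul (1 - m g ^ 2)).const_add (m g * m k)
      · simp
    · exact tendsto_finsetSum _ fun g _ => (hfrac g).mul_const _
  rw [← hlim.liminf_eq]
  refine liminf_le_liminf ?_ hlim.isBoundedUnder_ge ?_
  · filter_upwards [eventually_ge_atTop p] with N hN
    exact press_lower J h P N (hp.trans hN) m hm' (hdisj N) (hcover N hN) (hcard N hN)
  · apply IsBoundedUnder.isCoboundedUnder_ge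
    refine isBoundedUnder_of_eventually_le (a := Real.log 2 + (1 / 2 * ∑ g, ∑ k, |J g k| + ∑ g, |h g|)) ?_
    filter_upwards [eventually_ge_atTop 1] with N hN
    exact press_upper J h P N hN
end
end
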